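/- arXiv:1905.08549 — 4 statements merged into one kernel-verified Lean document; each statement's English description precedes it below -/
import Mathlib

section
/- Let a be a real number with 1/4 ≤ a < 1 and let θ = arccos(1 − 1/(2a)). Then the complex identity e^{iθ}(1 − e^{iθ})a = (1 − e^{iθ})a + e^{iθ} holds; more generally it holds with θ replaced by θ + 2k₁π in the outer exponential and θ + 2k₂π in the inner exponentials for any integers k₁, k₂. -/
theorem exp_I_mul_add_two_int_mul_pi (θ : ℝ) (k : ℤ) :
    Complex.exp (Complex.I * ((θ + 2 * k * Real.pi : ℝ) : ℂ)) =
      Real.cos θ + Real.sin θ * Complex.I := by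
  rw [mul_comm, Complex.exp_mul_I, ← Complex.ofReal_cos, ← Complex.ofReal_sin,
    show θ + 2 * k * Real.pi = θ + k * (2 * Real.pi) by ring,
    Real.cos_add_int_mul_two_pi, Real.sin_add_int_mul_two_pi]

/-- phase matching for exact amplitude amplification: for
`1/4 ≤ a < 1` and `θ = arccos(1 − 1/(2a))`, the identity
`e^{iφ}(1 − e^{iϕ})a = (1 − e^{iϕ})a + e^{iϕ}` holds with
`φ = θ + 2k₁π` and `ϕ = θ + 2k₂π` for any integers `k₁, k₂`. -/
theorem stmt_8 (a : ℝ) (ha : 1/4 ≤ a) (ha' : a < 1)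
    (θ : ℝ) (hθ : θ = Real.arccos (1 - 1/(2*a))) (k₁ k₂ : ℤ) :
    Complex.exp (Complex.I * ((θ + 2 * k₁ * Real.pi : ℝ) : ℂ)) *
        ((1 - Complex.exp (Complex.I * ((θ + 2 * k₂ * Real.pi : ℝ) : ℂ))) * (a : ℂ)) =
      (1 - Complex.exp (Complex.I * ((θ + 2 * k₂ * Real.pi : ℝ) : ℂ))) * (a : ℂ) +
        Complex.exp (Complex.I * ((θ + 2 * k₂ * Real.pi : ℝ) : ℂ)) := by
  have ha₀ : 0 < a := by linarith
  have hcos : Real.cos θ = 1 - 1 / (2 * a) := by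
    rw [hθ, Real.cos_arccos]
    · have : 1 / (2 * a) ≤ 2 := by
        rw [div_le_iff₀ (by positivity)]
        linarith
      linarith
    · have : 0 < 1 / (2 * a) := by positivity
      linarith
  have hlin : 2 * a * Real.cos θ = 2 * a - 1 := by
    rw [hcos]
    field_simp
  have hlin' : 2 * (a : ℂ) * (Real.cos θ : ℂ) = 2 * a - 1 := by exact_mod_cast hlin
  have hsq : (Real.sin θ : ℂ) ^ 2 + (Real.cos θ : ℂ) ^ 2 = 1 := by
    exact_mod_cast Real.sin_sq_add_cos_sq θ
  rw [exp_I_mul_add_two_int_mul_pi, exp_I_mul_add_two_int_mul_pi]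
  generalize (Real.cos θ : ℂ) = c at *
  generalize (Real.sin θ : ℂ) = s at *
  linear_combination a * hsq - (c + s * Complex.I) * hlin' - a * s ^ 2 * Complex.I_sq
end

section
/- Let c > 0 be a constant, let n and k be natural numbers with k ≤ n, and let P be a real polynomial with the following properties: (1) for every integer 0 ≤ i ≤ n, |P(2^i)| ≤ 1; (2) for some real number x₀ with 1 ≤ x₀ ≤ 2^k, |P'(x₀)| ≥ c. Then deg(P) ≥ min( (n−k)/2, (n + 2 + log₂ c)/4 ). -/
open Polynomial in
/-- A polynomial whose derivative has no root in `(a, b)` takes values on `[a, b]` bounded by those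
at the endpoints. -/
lemma Polynomial.abs_eval_le_of_derivative_ne_zero (P : ℝ[X]) {a b m B : ℝ} (ham : a ≤ m)
    (hmb : m ≤ b) (hroot : ∀ x ∈ Set.Ioo a b, P.derivative.eval x ≠ 0)
    (ha : |P.eval a| ≤ B) (hb : |P.eval b| ≤ B) : |P.eval m| ≤ B := by
  have key : ∀ u v, u ∈ Set.Icc a b → v ∈ Set.Icc a b → u < v → P.eval u ≠ P.eval v := by
    intro u v hu hv huv h
    obtain ⟨x, hx, hx0⟩ := exists_hasDerivAt_eq_zero huv P.continuousOn h
      (fun x _ ↦ P.hasDerivAt x)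
    exact hroot x ⟨hu.1.trans_lt hx.1, hx.2.trans_le hv.2⟩ hx0
  have hinj : Set.InjOn (fun x ↦ P.eval x) (Set.Icc a b) := by
    intro u hu v hv h
    rcases lt_trichotomy u v with huv | huv | huv
    · exact absurd h (key u v hu hv huv)
    · exact huv
    · exact absurd h.symm (key v u hv hu huv)
  have hab := ham.trans hmb
  have hm : m ∈ Set.Icc a b := ⟨ham, hmb⟩
  have hl := Set.left_mem_Icc.2 hab
  have hr := Set.right_mem_Icc.2 hab
  rw [abs_le] at *
  rcases ContinuousOn.strictMonoOn_of_injOn_Icc' hab P.continuousOn hinj with h | h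
  · have h1 := h.monotoneOn hl hm ham
    have h2 := h.monotoneOn hm hr hmb
    constructor <;> linarith
  · have h1 := h.antitoneOn hl hm ham
    have h2 := h.antitoneOn hm hr hmb
    constructor <;> linarith

open Polynomial in
/-- If `|P| ≤ 1` at `a < b`, then the derivative is at most `2 / (b - a)` somewhere between. -/
lemma Polynomial.exists_abs_derivative_le (P : ℝ[X]) {a b : ℝ} (hab : a < b)
    (ha : |P.eval a| ≤ 1) (hb : |P.eval b| ≤ 1) :
    ∃ x ∈ Set.Ioo a b, |P.derivative.eval x| ≤ 2 / (b - a) := by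
  obtain ⟨x, hx, h⟩ := exists_hasDerivAt_eq_slope (fun x ↦ P.eval x) _ hab P.continuousOn
    (fun x _ ↦ P.hasDerivAt x)
  refine ⟨x, hx, ?_⟩
  rw [h, abs_div, abs_of_pos (sub_pos.2 hab)]
  refine div_le_div_of_nonneg_right ?_ (sub_pos.2 hab).le
  rw [abs_le] at ha hb ⊢
  constructor <;> linarith

open Polynomial in
/-- If `P` is bounded by `1` at `a` and `b`, and neither `P'` nor `P''` vanishes in `(a, b)`, then
`|P'|` at the midpoint is at most `4 / (b - a)`. -/
lemma Polynomial.abs_derivative_midpoint_le (P : ℝ[X]) {a b : ℝ} (hab : a < b)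
    (ha : |P.eval a| ≤ 1) (hb : |P.eval b| ≤ 1)
    (h1 : ∀ x ∈ Set.Ioo a b, P.derivative.eval x ≠ 0)
    (h2 : ∀ x ∈ Set.Ioo a b, P.derivative.derivative.eval x ≠ 0) :
    |P.derivative.eval ((a + b) / 2)| ≤ 4 / (b - a) := by
  have hm := P.abs_eval_le_of_derivative_ne_zero (m := (a + b) / 2) (by linarith) (by linarith)
    h1 ha hb
  obtain ⟨u, hu, hu'⟩ := P.exists_abs_derivative_le (by linarith) ha hm
  obtain ⟨v, hv, hv'⟩ := P.exists_abs_derivative_le (by linarith) hm hb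
  have hba : b - a ≠ 0 := (sub_pos.2 hab).ne'
  rw [show 2 / ((a + b) / 2 - a) = 4 / (b - a) by
    rw [show (a + b) / 2 - a = (b - a) / 2 by ring]; field_simp; norm_num] at hu'
  rw [show 2 / (b - (a + b) / 2) = 4 / (b - a) by
    rw [show b - (a + b) / 2 = (b - a) / 2 by ring]; field_simp; norm_num] at hv'
  exact P.derivative.abs_eval_le_of_derivative_ne_zero hu.2.le hv.1.le
    (fun x hx ↦ h2 x ⟨hu.1.trans hx.1, hx.2.trans hv.2⟩) hu' hv'

open Polynomial in
/-- If `x` is at most `C` times as far as `y` from every root of `Q`, then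
`|Q x| ≤ C ^ deg Q * |Q y|`. -/
lemma Polynomial.norm_eval_le_pow_mul_norm_eval (Q : ℂ[X]) {x y : ℂ} {C : ℝ} (hC : 0 ≤ C)
    (h : ∀ z ∈ Q.roots, ‖x - z‖ ≤ C * ‖y - z‖) :
    ‖Q.eval x‖ ≤ C ^ Q.natDegree * ‖Q.eval y‖ := by
  have hs := IsAlgClosed.splits Q
  have hprod : ∀ s : Multiset ℂ, (∀ z ∈ s, ‖x - z‖ ≤ C * ‖y - z‖) →
      ‖(s.map (x - ·)).prod‖ ≤ C ^ s.card * ‖(s.map (y - ·)).prod‖ := by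
    intro s
    induction s using Multiset.induction_on with
    | empty => simp
    | cons z s ih =>
      intro hz
      have h1 := hz z (Multiset.mem_cons_self z s)
      have h2 := ih fun w hw ↦ hz w (Multiset.mem_cons_of_mem hw)
      simp only [Multiset.map_cons, Multiset.prod_cons, norm_mul, Multiset.card_cons]
      calc _ ≤ (C * ‖y - z‖) * (C ^ s.card * ‖(s.map (y - ·)).prod‖) := by gcongr
        _ = _ := by ring
  rw [hs.eval_eq_prod_roots, hs.eval_eq_prod_roots, norm_mul, norm_mul, hs.natDegree_eq_card_roots]
  calc _ ≤ ‖Q.leadingCoeff‖ * (C ^ Q.roots.card * ‖(Q.roots.map (y - ·)).prod‖) := by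
        gcongr; exact hprod _ h
    _ = _ := by ring

/-- If there are more dyadic intervals than points, some open dyadic interval avoids the points. -/
lemma Finset.exists_dyadic_Ioo_disjoint (S : Finset ℝ) {m n : ℕ} (h : S.card < n - m) :
    ∃ j, m ≤ j ∧ j < n ∧ ∀ s ∈ S, s ∉ Set.Ioo ((2 : ℝ) ^ j) (2 ^ (j + 1)) := by
  by_contra! hcon
  have hcon' : ∀ j ∈ Finset.Ico m n, ∃ s ∈ S, s ∈ Set.Ioo ((2 : ℝ) ^ j) (2 ^ (j + 1)) :=
    fun j hj ↦ hcon j (Finset.mem_Ico.1 hj).1 (Finset.mem_Ico.1 hj).2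
  choose! f hf hf' using hcon'
  have hlt : ∀ i j, i ∈ Finset.Ico m n → j ∈ Finset.Ico m n → f i = f j → i ≤ j := by
    intro i j hi hj hij
    have h1 := (hf' i hi).1.trans (hij ▸ (hf' j hj).2)
    have := (pow_lt_pow_iff_right₀ (one_lt_two : (1 : ℝ) < 2)).1 h1
    omega
  have := Finset.card_le_card_of_injOn f hf
    (fun i hi j hj hij ↦ (hlt i j hi hj hij).antisymm (hlt j i hj hi hij.symm))
  rw [Nat.card_Ico] at this
  omega

/-- A point `z` with real part outside `(D, 2 D)` is at most four times as far from `x ∈ [0, D]` as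
from `3 D / 2`. -/
lemma Complex.norm_sub_le_four_mul {x D : ℝ} (hx : 0 ≤ x) (hxD : x ≤ D) {z : ℂ}
    (hz : z.re ∉ Set.Ioo D (2 * D)) :
    ‖(x : ℂ) - z‖ ≤ 4 * ‖(((D + 2 * D) / 2 : ℝ) : ℂ) - z‖ := by
  have hre : |x - z.re| ≤ |4 * ((D + 2 * D) / 2 - z.re)| := by
    rw [Set.mem_Ioo, not_and_or, not_lt, not_lt] at hz
    rcases hz with hz | hz
    · rw [abs_of_nonneg (a := 4 * ((D + 2 * D) / 2 - z.re)) (by linarith), abs_le]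
      constructor <;> linarith
    · rw [abs_of_nonpos (a := 4 * ((D + 2 * D) / 2 - z.re)) (by linarith), abs_le]
      constructor <;> linarith
  have hsq := sq_le_sq.2 hre
  refine (sq_le_sq₀ (by positivity) (by positivity)).1 ?_
  rw [mul_pow, Complex.sq_norm, Complex.sq_norm, Complex.normSq_apply, Complex.normSq_apply]
  simp only [Complex.sub_re, Complex.sub_im, Complex.ofReal_re, Complex.ofReal_im]
  nlinarith [sq_nonneg z.im]

open Polynomial in
/-- A polynomial bounded by `1` at `2 ^ i` for `i ≤ n` has derivative at most `2 ^ (4 d - n - 2)`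
on `[1, 2 ^ k]`, where `d` is its degree, provided that `2 d < n - k`. -/
lemma Polynomial.abs_derivative_mul_two_pow_le {n k : ℕ} (P : ℝ[X])
    (h1 : ∀ i : ℕ, i ≤ n → |P.eval ((2 : ℝ) ^ i)| ≤ 1) {x₀ : ℝ} (hx : 1 ≤ x₀)
    (hxk : x₀ ≤ (2 : ℝ) ^ k) (hdeg : 2 * P.natDegree + k < n) (h0 : P.derivative ≠ 0) :
    |P.derivative.eval x₀| * 2 ^ (n + 2) ≤ 2 ^ (4 * P.natDegree) := by
  have hd : 1 ≤ P.natDegree := by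
    by_contra! hlt
    exact h0 (derivative_of_natDegree_zero (by omega))
  have hd1 := natDegree_derivative_le P
  have hd2 := natDegree_derivative_le P.derivative
  by_cases h00 : P.derivative.derivative = 0
  · obtain ⟨e, he⟩ : ∃ e, P.derivative = C e :=
      ⟨_, eq_C_of_natDegree_eq_zero (derivative_eq_zero.1 h00)⟩
    obtain ⟨m, rfl⟩ : ∃ m, n = m + 1 := ⟨n - 1, by omega⟩
    have hm : (1 : ℝ) ≤ 2 ^ m := one_le_pow₀ one_le_two
    obtain ⟨x, -, hx'⟩ := P.exists_abs_derivative_le (a := 2 ^ 0) (b := 2 ^ (m + 1))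
      (by rw [pow_succ]; linarith) (h1 0 (by omega)) (h1 _ le_rfl)
    rw [he, eval_C] at hx' ⊢
    rw [le_div_iff₀ (by rw [pow_succ]; linarith)] at hx'
    calc |e| * 2 ^ (m + 1 + 2) = 8 * (|e| * 2 ^ m) := by ring
      _ ≤ 8 * (|e| * (2 ^ (m + 1) - 2 ^ 0)) := by
        gcongr; rw [pow_succ]; linarith
      _ ≤ 2 ^ 4 := by linarith
      _ ≤ 2 ^ (4 * P.natDegree) := pow_le_pow_right₀ one_le_two (by omega)
  have hd1' : 1 ≤ P.derivative.natDegree := by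
    by_contra! hlt
    exact h00 (derivative_of_natDegree_zero (by omega))
  set W : ℂ[X] := (P.derivative * P.derivative.derivative).map Complex.ofRealHom with hW
  have hW0 : W ≠ 0 := by
    rw [hW, Polynomial.map_ne_zero_iff Complex.ofRealHom.injective]
    exact mul_ne_zero h0 h00
  have hWcard : (W.roots.map Complex.re).toFinset.card < n - (n + 2 - 2 * P.natDegree) := by
    have e1 := (W.roots.map Complex.re).toFinset_card_le
    rw [Multiset.card_map] at e1
    have e2 := W.card_roots'
    rw [hW, natDegree_map, natDegree_mul h0 h00, ← hW] at e2
    omega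
  obtain ⟨j, hj, hjn, havoid⟩ := Finset.exists_dyadic_Ioo_disjoint _ hWcard
  set D : ℝ := 2 ^ j with hD
  have hDpos : 0 < D := by positivity
  rw [pow_succ', ← hD] at havoid
  have hroot : ∀ z : ℂ, W.eval z = 0 → z.re ∉ Set.Ioo D (2 * D) := fun z hz ↦
    havoid _ (Multiset.mem_toFinset.2 (Multiset.mem_map_of_mem _ ((mem_roots hW0).2 hz)))
  have hreal : ∀ x ∈ Set.Ioo D (2 * D), (P.derivative * P.derivative.derivative).eval x ≠ 0 := by
    intro x hx' hz
    refine hroot x ?_ (by simpa using hx')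
    rw [hW, ← Complex.ofRealHom_eq_coe, eval_map_apply, hz, map_zero]
  have hmid := P.abs_derivative_midpoint_le (a := D) (b := 2 * D) (by linarith) (h1 j hjn.le)
    (by rw [hD, ← pow_succ']; exact h1 (j + 1) hjn)
    (fun x hx' hz ↦ hreal x hx' (by rw [eval_mul, hz, zero_mul]))
    (fun x hx' hz ↦ hreal x hx' (by rw [eval_mul, hz, mul_zero]))
  have hxD : x₀ ≤ D := hxk.trans (pow_le_pow_right₀ one_le_two (by omega))
  have hnorm : ∀ x : ℝ, ‖(P.derivative.map Complex.ofRealHom).eval (x : ℂ)‖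
      = |P.derivative.eval x| := by
    intro x
    rw [← Complex.ofRealHom_eq_coe, eval_map_apply, Complex.ofRealHom_eq_coe, Complex.norm_real,
      Real.norm_eq_abs]
  have hratio := (P.derivative.map Complex.ofRealHom).norm_eval_le_pow_mul_norm_eval
    (x := x₀) (y := ((D + 2 * D) / 2 : ℝ)) (C := 4) (by norm_num) (fun z hz ↦
      Complex.norm_sub_le_four_mul (by linarith) hxD (hroot z (by
        rw [hW, Polynomial.map_mul, eval_mul, (isRoot_of_mem_roots hz).eq_zero, zero_mul])))
  rw [hnorm, hnorm, natDegree_map] at hratio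
  rw [show 2 * D - D = D by ring, le_div_iff₀ hDpos] at hmid
  calc |P.derivative.eval x₀| * 2 ^ (n + 2)
      ≤ (4 ^ P.derivative.natDegree * |P.derivative.eval ((D + 2 * D) / 2)|)
        * 2 ^ (j + 2 * P.natDegree) := by
        exact mul_le_mul hratio (pow_le_pow_right₀ one_le_two (by omega)) (by positivity)
          (by positivity)
    _ = 4 ^ P.derivative.natDegree * (|P.derivative.eval ((D + 2 * D) / 2)| * D)
        * 2 ^ (2 * P.natDegree) := by rw [hD]; ring
    _ ≤ 4 ^ P.derivative.natDegree * 4 * 2 ^ (2 * P.natDegree) := by gcongr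
    _ = 2 ^ (2 * P.derivative.natDegree + 2 + 2 * P.natDegree) := by
        rw [pow_add, pow_add, pow_mul 2 2 P.derivative.natDegree,
          show (2 : ℝ) ^ 2 = 4 by norm_num]
    _ ≤ 2 ^ (4 * P.natDegree) := pow_le_pow_right₀ one_le_two (by omega)

/-- if `|P(2^i)| ≤ 1` for all integers `0 ≤ i ≤ n` and
`|P'(x₀)| ≥ c` for some `x₀ ∈ [1, 2^k]`, then
`deg P ≥ min((n−k)/2, (n + 2 + log₂ c)/4)`. -/
theorem stmt_9 (c : ℝ) (hc : 0 < c) (n k : ℕ) (hk : k ≤ n) (P : Polynomial ℝ)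
    (h1 : ∀ i : ℕ, i ≤ n → |P.eval ((2:ℝ)^i)| ≤ 1)
    (h2 : ∃ x₀ : ℝ, 1 ≤ x₀ ∧ x₀ ≤ (2:ℝ)^k ∧ c ≤ |P.derivative.eval x₀|) :
    min (((n:ℝ) - k)/2) (((n:ℝ) + 2 + Real.logb 2 c)/4) ≤ (P.natDegree : ℝ) := by
  obtain ⟨x₀, hx, hxk, hcx⟩ := h2
  rcases le_or_gt n (2 * P.natDegree + k) with hdeg | hdeg
  · refine (min_le_left _ _).trans ?_
    have : (n : ℝ) ≤ 2 * P.natDegree + k := by exact_mod_cast hdeg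
    linarith
  · refine (min_le_right _ _).trans ?_
    have h0 : P.derivative ≠ 0 := by
      intro h0
      rw [h0, Polynomial.eval_zero, abs_zero] at hcx
      linarith
    have hbound : c * 2 ^ (n + 2) ≤ 2 ^ (4 * P.natDegree) :=
      (mul_le_mul_of_nonneg_right hcx (by positivity)).trans
        (P.abs_derivative_mul_two_pow_le h1 hx hxk hdeg h0)
    have hlog := Real.logb_le_logb_of_le one_lt_two (by positivity) hbound
    rw [Real.logb_mul hc.ne' (by positivity), Real.logb_pow, Real.logb_pow,
      Real.logb_self_eq_one one_lt_two] at hlog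
    push_cast at hlog
    linarith
end

section
/- Let n and k be natural numbers with 1 ≤ k ≤ n, let 0 ≤ ε < 1/2, and let Q be a real polynomial such that 0 ≤ Q(2^i) ≤ 1 for every integer 0 ≤ i ≤ n, Q(1) ≤ ε, and Q(2^k) ≥ 1 − ε. Then deg(Q) ≥ min( (n−k)/2, (n − k + 3 + log₂(1 − 2ε))/4 ). -/
/-- Distinct powers of two `2 ^ a ≠ 2 ^ b` are at distance at least half of the second one. -/
lemma two_pow_le_two_mul_abs_sub {a b : ℕ} (h : a ≠ b) :
    (2:ℝ)^b ≤ 2 * |(2:ℝ)^a - 2^b| := by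
  have key : ∀ {c d : ℕ}, c < d → 2 * (2:ℝ)^c ≤ 2^d := fun {c d} hcd => by
    rw [← pow_succ']
    exact pow_le_pow_right₀ one_le_two hcd
  have hb : (0:ℝ) < 2^b := by positivity
  rcases lt_or_gt_of_ne h with h | h
  · have := key h
    have := neg_le_abs ((2:ℝ)^a - 2^b)
    linarith
  · have := key h
    have := le_abs_self ((2:ℝ)^a - 2^b)
    linarith

/-- The Lagrange basis polynomials at the nodes `2 ^ n, 2 ^ (n - 1), …, 2 ^ (n - e)` are at most
`2 ^ e` in absolute value at a power of two below all the nodes. -/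
lemma abs_eval_basis_two_pow_le {n k e i : ℕ} (hkn : k + e ≤ n) (hi : i < e + 1) :
    |(Lagrange.basis (Finset.range (e + 1)) (fun j => (2:ℝ)^(n - j)) i).eval ((2:ℝ)^k)|
      ≤ 2^e := by
  rw [Lagrange.basis, Polynomial.eval_prod, Finset.abs_prod]
  have hcard : ((Finset.range (e + 1)).erase i).card = e := by
    simp [Finset.card_erase_of_mem (Finset.mem_range.2 hi)]
  calc _ ≤ ∏ _j ∈ (Finset.range (e + 1)).erase i, (2:ℝ) := by
        refine Finset.prod_le_prod (fun _ _ => abs_nonneg _) fun j hj => ?_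
        obtain ⟨hji, hj⟩ := Finset.mem_erase.1 hj
        have hj := Finset.mem_range.1 hj
        have hlow := two_pow_le_two_mul_abs_sub (a := n - i) (b := n - j) (by omega)
        have hb : (0:ℝ) < 2^(n - j) := by positivity
        have hk : (0:ℝ) < 2^k := by positivity
        have hkj : (2:ℝ)^k ≤ 2^(n - j) := pow_le_pow_right₀ one_le_two (by omega)
        have hpos : 0 < |(2:ℝ)^(n - i) - 2^(n - j)| := by linarith
        have hup : |(2:ℝ)^k - 2^(n - j)| ≤ 2^(n - j) := by
          rw [abs_le]; constructor <;> linarith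
        simp only [Lagrange.basisDivisor, Polynomial.eval_mul, Polynomial.eval_C,
          Polynomial.eval_sub, Polynomial.eval_X, abs_mul, abs_inv]
        rw [inv_mul_le_iff₀ hpos]
        linarith
    _ = 2^e := by rw [Finset.prod_const, hcard]

/-- A polynomial of degree at most `e + 1` with values in `[0, 1]` at the powers of two up to
`2 ^ n` varies little between `1` and `2 ^ k`. -/
lemma abs_eval_two_pow_sub_eval_one_mul_le {n k e : ℕ} (hk1 : 1 ≤ k) (hkn : k + e ≤ n)
    {Q : Polynomial ℝ} (hdeg : Q.natDegree ≤ e + 1)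
    (h01 : ∀ i : ℕ, i ≤ n → 0 ≤ Q.eval ((2:ℝ)^i) ∧ Q.eval ((2:ℝ)^i) ≤ 1) :
    |Q.eval ((2:ℝ)^k) - Q.eval 1| * 2^n ≤ 2^(3 * e + k) := by
  set S := Q /ₘ (Polynomial.X - Polynomial.C 1) with hS
  have hSeval : ∀ x, Q.eval x - Q.eval 1 = (x - 1) * S.eval x := fun x => by
    have h := congrArg (Polynomial.eval x)
      (Polynomial.modByMonic_add_div Q (Polynomial.X - Polynomial.C (1:ℝ)))
    rw [Polynomial.modByMonic_X_sub_C_eq_C_eval] at h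
    simp only [Polynomial.eval_add, Polynomial.eval_C, Polynomial.eval_mul,
      Polynomial.eval_sub, Polynomial.eval_X] at h
    linarith
  have hSdeg : S.degree < (Finset.range (e + 1)).card := by
    have hnat : S.natDegree < e + 1 := by
      rw [hS, Polynomial.natDegree_divByMonic _ (Polynomial.monic_X_sub_C 1),
        Polynomial.natDegree_X_sub_C]
      omega
    rw [Finset.card_range]
    exact Polynomial.degree_le_natDegree.trans_lt (by exact_mod_cast hnat)
  have hinj : Set.InjOn (fun j => (2:ℝ)^(n - j)) (Finset.range (e + 1)) := by
    intro a ha b hb hab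
    have ha := Finset.mem_range.1 ha
    have hb := Finset.mem_range.1 hb
    have := pow_right_injective₀ (by norm_num : (0:ℝ) < 2) (by norm_num) hab
    omega
  have hk : (1:ℝ) < 2^k := one_lt_pow₀ one_lt_two (by omega)
  have hterm : ∀ i ∈ Finset.range (e + 1),
      (2^k - 1) * |S.eval ((2:ℝ)^(n - i))| * 2^n ≤ 2^k * 2^e := by
    intro i hi
    have hi := Finset.mem_range.1 hi
    have hv : (2:ℝ)^k ≤ 2^(n - i) := pow_le_pow_right₀ one_le_two (by omega)
    have hbound : (2^(n - i) - 1) * |S.eval ((2:ℝ)^(n - i))| ≤ 1 := by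
      rw [← abs_of_pos (by linarith : (0:ℝ) < 2^(n - i) - 1), ← abs_mul, ← hSeval, abs_le]
      have h0 := h01 0 (by omega)
      rw [pow_zero] at h0
      have h1 := h01 (n - i) (by omega)
      constructor <;> linarith [h0.1, h0.2, h1.1, h1.2]
    have hsplit : (2:ℝ)^n = 2^(n - i) * 2^i := by
      rw [← pow_add]; congr 1; omega
    have hie : (2:ℝ)^i ≤ 2^e := pow_le_pow_right₀ one_le_two (by omega)
    have hs := abs_nonneg (S.eval ((2:ℝ)^(n - i)))
    have hcross : (2^k - 1) * (2:ℝ)^(n - i) ≤ 2^k * (2^(n - i) - 1) := by linarith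
    calc (2^k - 1) * |S.eval ((2:ℝ)^(n - i))| * 2^n
        = ((2^k - 1) * (2:ℝ)^(n - i)) * |S.eval ((2:ℝ)^(n - i))| * 2^i := by
          rw [hsplit]; ring
      _ ≤ (2^k * (2^(n - i) - 1)) * |S.eval ((2:ℝ)^(n - i))| * 2^i := by gcongr
      _ = 2^k * ((2^(n - i) - 1) * |S.eval ((2:ℝ)^(n - i))|) * 2^i := by ring
      _ ≤ 2^k * 1 * 2^e := by gcongr
      _ = 2^k * 2^e := by ring
  have hinterp : S.eval ((2:ℝ)^k) = ∑ i ∈ Finset.range (e + 1), S.eval ((2:ℝ)^(n - i)) *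
      (Lagrange.basis (Finset.range (e + 1)) (fun j => (2:ℝ)^(n - j)) i).eval ((2:ℝ)^k) := by
    conv_lhs => rw [Lagrange.eq_interpolate hinj hSdeg]
    simp [Lagrange.interpolate_apply, Polynomial.eval_finsetSum]
  calc |Q.eval ((2:ℝ)^k) - Q.eval 1| * 2^n
      = (2^k - 1) * |S.eval ((2:ℝ)^k)| * 2^n := by
        rw [hSeval, abs_mul, abs_of_pos (by linarith : (0:ℝ) < 2^k - 1)]
    _ ≤ (2^k - 1) * (∑ i ∈ Finset.range (e + 1), |S.eval ((2:ℝ)^(n - i))| * 2^e) * 2^n := by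
        have : (0:ℝ) ≤ 2^k - 1 := by linarith
        gcongr
        rw [hinterp]
        refine (Finset.abs_sum_le_sum_abs _ _).trans (Finset.sum_le_sum fun i hi => ?_)
        rw [abs_mul]
        gcongr
        exact abs_eval_basis_two_pow_le hkn (Finset.mem_range.1 hi)
    _ = ∑ i ∈ Finset.range (e + 1), (2^k - 1) * |S.eval ((2:ℝ)^(n - i))| * 2^n * 2^e := by
        rw [Finset.mul_sum, Finset.sum_mul]
        exact Finset.sum_congr rfl fun _ _ => by ring
    _ ≤ ∑ _i ∈ Finset.range (e + 1), (2:ℝ)^k * 2^e * 2^e :=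
        Finset.sum_le_sum fun i hi => by gcongr ?_ * _; exact hterm i hi
    _ = ((e + 1 : ℕ) : ℝ) * (2^k * 2^e * 2^e) := by
        rw [Finset.sum_const, Finset.card_range, nsmul_eq_mul]
    _ ≤ 2^e * (2^k * 2^e * 2^e) := by
        gcongr
        exact_mod_cast Nat.lt_two_pow_self (n := e)
    _ = 2^(3 * e + k) := by ring


/-- core of the Ω(n−k) lower bound: if `0 ≤ Q(2^i) ≤ 1` for all
integers `0 ≤ i ≤ n`, `Q(1) ≤ ε` and `Q(2^k) ≥ 1 − ε` with `1 ≤ k ≤ n` and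
`0 ≤ ε < 1/2`, then `deg Q ≥ min((n−k)/2, (n−k+3+log₂(1−2ε))/4)`. -/
theorem stmt_12 (n k : ℕ) (hk1 : 1 ≤ k) (hkn : k ≤ n)
    (ε : ℝ) (hε0 : 0 ≤ ε) (hε : ε < 1/2) (Q : Polynomial ℝ)
    (h01 : ∀ i : ℕ, i ≤ n → 0 ≤ Q.eval ((2:ℝ)^i) ∧ Q.eval ((2:ℝ)^i) ≤ 1)
    (h1 : Q.eval 1 ≤ ε) (h2 : 1 - ε ≤ Q.eval ((2:ℝ)^k)) :
    min (((n:ℝ) - k)/2) (((n:ℝ) - k + 3 + Real.logb 2 (1 - 2*ε))/4)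
      ≤ (Q.natDegree : ℝ) := by
  rw [min_le_iff]
  by_contra! hlt
  obtain ⟨hlt₁, hlt₂⟩ := hlt
  have hdeg : 2 * Q.natDegree + k < n := by
    have : (2:ℝ) * Q.natDegree + k < n := by linarith
    exact_mod_cast this
  rcases Nat.eq_zero_or_pos Q.natDegree with hd | hd
  · rw [Polynomial.eq_C_of_natDegree_eq_zero hd, Polynomial.eval_C] at h1 h2
    linarith
  obtain ⟨e, he⟩ : ∃ e, Q.natDegree = e + 1 := ⟨Q.natDegree - 1, by omega⟩
  have hvar := abs_eval_two_pow_sub_eval_one_mul_le hk1 (by omega : k + e ≤ n) he.le h01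
  have hpos : 0 < 1 - 2 * ε := by linarith
  have hle : (1 - 2 * ε) * 2^n ≤ 2^(3 * e + k) := by
    refine le_trans ?_ hvar
    gcongr
    exact le_trans (by linarith) (le_abs_self _)
  have hlog := Real.logb_le_logb_of_le one_lt_two (by positivity) hle
  rw [Real.logb_mul hpos.ne' (by positivity), Real.logb_pow, Real.logb_pow,
    Real.logb_self_eq_one one_lt_two] at hlog
  rw [he] at hlt₂
  push_cast at hlog hlt₂
  have : (0:ℝ) ≤ e := e.cast_nonneg
  linarith
end

section
/- For every natural number n ≥ 1 there exists a set C ⊆ {0,1}^n with |C| = 2^{⌊n/2⌋} + 2^{⌈n/2⌉} − 1 ≤ 2·√(2^{n+1}) such that C is a query set of {0,1}^n, i.e., for every x ∈ {0,1}^n there exist y, z ∈ C with x = y ⊕ z. Concretely, one may take C = B_front ∪ B_back, where B_front = {b ∈ {0,1}^n : b_j = 0 for all 1 ≤ j ≤ ⌊n/2⌋} and B_back = {b ∈ {0,1}^n : b_j = 0 for all ⌊n/2⌋ + 1 ≤ j ≤ n}. -/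
theorem ncard_setOf_forall_imp_eq_zero {ι α : Type*} [Fintype ι] [Fintype α] [Zero α]
    (p : ι → Prop) [DecidablePred p] :
    {b : ι → α | ∀ j, p j → b j = 0}.ncard =
      Fintype.card α ^ (Finset.univ.filter fun j => ¬ p j).card := by
  classical
  have h : {b : ι → α | ∀ j, p j → b j = 0} =
      ↑(Fintype.piFinset fun j => if p j then ({0} : Finset α) else Finset.univ) := by
    ext b
    simp only [Set.mem_ofPred_eq, Finset.mem_coe, Fintype.mem_piFinset]
    refine forall_congr' fun j => ?_
    by_cases hj : p j <;> simp [hj]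
  rw [h, Set.ncard_coe_finset, Fintype.card_piFinset, ← Finset.prod_const, Finset.prod_filter]
  refine Finset.prod_congr rfl fun j _ => ?_
  by_cases hj : p j <;> simp [hj]

theorem card_filter_val_lt_of_le {n m : ℕ} (h : m ≤ n) :
    (Finset.univ.filter fun j : Fin n => (j : ℕ) < m).card = m := by
  simp [Fin.card_filter_val_lt, h]

theorem card_filter_not_val_lt {n m : ℕ} (h : m ≤ n) :
    (Finset.univ.filter fun j : Fin n => ¬ (j : ℕ) < m).card = n - m := by
  have := Finset.card_filter_add_card_filter_not (s := Finset.univ) (fun j : Fin n => (j : ℕ) < m)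
  rw [card_filter_val_lt_of_le h, Finset.card_univ, Fintype.card_fin] at this
  omega

theorem two_pow_half_add_le (n : ℕ) :
    (2 : ℝ) ^ (n / 2) + 2 ^ (n - n / 2) ≤ 2 * Real.sqrt (2 ^ (n + 1)) := by
  have h : ((2 : ℝ) ^ (n / 2) + 2 ^ (n - n / 2)) / 2 ≤ Real.sqrt (2 ^ (n + 1)) := by
    apply Real.le_sqrt_of_sq_le
    rcases Nat.even_or_odd' n with ⟨k, rfl | rfl⟩
    · rw [show 2 * k / 2 = k by omega, show 2 * k - k = k by omega]
      ring_nf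
      nlinarith [pow_pos (show (0 : ℝ) < 2 by norm_num) (k * 2)]
    · rw [show (2 * k + 1) / 2 = k by omega, show 2 * k + 1 - k = k + 1 by omega]
      ring_nf
      nlinarith [pow_pos (show (0 : ℝ) < 2 by norm_num) (k * 2)]
  linarith

/-- the concrete set `C = B_front ∪ B_back` has cardinality
`2^⌊n/2⌋ + 2^⌈n/2⌉ − 1 ≤ 2√(2^{n+1})` and is a query set of `{0,1}^n`:
every `x` is a XOR of two of its elements. -/
theorem stmt_13 (n : ℕ) (hn : 1 ≤ n)
    (Bfront Bback : Set (Fin n → ZMod 2))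
    (hBf : Bfront = {b | ∀ j : Fin n, (j : ℕ) < n/2 → b j = 0})
    (hBb : Bback = {b | ∀ j : Fin n, n/2 ≤ (j : ℕ) → b j = 0}) :
    (Bfront ∪ Bback).ncard = 2^(n/2) + 2^(n - n/2) - 1 ∧
    (((Bfront ∪ Bback).ncard : ℝ) ≤ 2 * Real.sqrt ((2:ℝ)^(n+1))) ∧
    ∀ x : Fin n → ZMod 2, ∃ y ∈ Bfront ∪ Bback, ∃ z ∈ Bfront ∪ Bback, x = y + z := by
  subst hBf hBb
  have hm : n / 2 ≤ n := Nat.div_le_self n 2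
  have hfront : {b : Fin n → ZMod 2 | ∀ j : Fin n, (j : ℕ) < n / 2 → b j = 0}.ncard =
      2 ^ (n - n / 2) := by
    rw [ncard_setOf_forall_imp_eq_zero, card_filter_not_val_lt hm, ZMod.card]
  have hback : {b : Fin n → ZMod 2 | ∀ j : Fin n, n / 2 ≤ (j : ℕ) → b j = 0}.ncard =
      2 ^ (n / 2) := by
    rw [ncard_setOf_forall_imp_eq_zero, ZMod.card]
    simp only [not_le, card_filter_val_lt_of_le hm]
  have hinter : {b : Fin n → ZMod 2 | ∀ j : Fin n, (j : ℕ) < n / 2 → b j = 0} ∩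
      {b | ∀ j : Fin n, n / 2 ≤ (j : ℕ) → b j = 0} = {0} := by
    ext b
    simp only [Set.mem_inter_iff, Set.mem_ofPred_eq, Set.mem_singleton_iff]
    constructor
    · rintro ⟨h₁, h₂⟩
      ext1 j
      exact (lt_or_ge (j : ℕ) (n / 2)).elim (h₁ j) (h₂ j)
    · rintro rfl
      simp
  have hcard := Set.ncard_union_add_ncard_inter
    {b : Fin n → ZMod 2 | ∀ j : Fin n, (j : ℕ) < n / 2 → b j = 0}
    {b | ∀ j : Fin n, n / 2 ≤ (j : ℕ) → b j = 0}
  rw [hinter, Set.ncard_singleton, hfront, hback] at hcard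
  refine ⟨by omega, ?_, fun x => ?_⟩
  · have hcardR := congrArg (Nat.cast : ℕ → ℝ) hcard
    push_cast at hcardR
    linarith [two_pow_half_add_le n]
  · refine ⟨fun j => if (j : ℕ) < n / 2 then 0 else x j, Or.inl fun j hj => by simp [hj],
      fun j => if (j : ℕ) < n / 2 then x j else 0, Or.inr fun j hj => by simp [hj.not_gt], ?_⟩
    ext1 j
    by_cases hj : (j : ℕ) < n / 2 <;> simp [hj]
end
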